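/- Let W = {w ∈ ℂ : |w − 1| < 1} be the open disc of radius 1 centered at 1. There do NOT exist an integer M ≥ 1, holomorphic functions g_1, …, g_M : W → ℂ with g_i(1) = 0 for all i, and an assignment of each index i ∈ {1, …, M} as 'lower' or 'upper', such that for all w ∈ W the product E_1(w) E_2(w) ⋯ E_M(w) equals the diagonal matrix with entries (1/w, w), where E_i(w) = [[1, 0], [g_i(w), 1]] if i is assigned 'lower' and E_i(w) = [[1, g_i(w)], [0, 1]] if i is assigned 'upper'. -/

import Mathlib

/-- The elementary unipotent `2 × 2` matrix with off-diagonal entry `c`. -/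
def elementaryUnipotent {R : Type*} [Zero R] [One R] (lower : Bool) (c : R) :
    Matrix (Fin 2) (Fin 2) R :=
  if lower then !![1, 0; c, 1] else !![1, c; 0, 1]

lemma elementaryUnipotent_zero {R : Type*} [Zero R] [One R] (lower : Bool) :
    elementaryUnipotent lower (0 : R) = 1 := by
  cases lower <;> simp [elementaryUnipotent, Matrix.one_fin_two]

/-- A product of unipotent triangular matrix functions that are all the identity at `x` has a
derivative at `x` with zero diagonal. -/
lemma prod_elementaryUnipotent_hasDerivAt {𝕜 : Type*} [NontriviallyNormedField 𝕜] {x : 𝕜}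
    {M : ℕ} (g : Fin M → 𝕜 → 𝕜) (lower : Fin M → Bool)
    (hg : ∀ i, DifferentiableAt 𝕜 (g i) x) (hx : ∀ i, g i x = 0) :
    ∃ D : Matrix (Fin 2) (Fin 2) 𝕜, (∀ i, D i i = 0) ∧ ∀ i j, HasDerivAt
      (fun w => (List.ofFn fun k => elementaryUnipotent (lower k) (g k w)).prod i j) (D i j) x := by
  induction M with
  | zero => exact ⟨0, by simp, fun i j => by simpa using hasDerivAt_const x _⟩
  | succ M ih =>
    obtain ⟨D, hD, hP⟩ := ih (fun i => g i.succ) (fun i => lower i.succ)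
      (fun i => hg i.succ) fun i => hx i.succ
    obtain ⟨E, hE, hF⟩ : ∃ E : Matrix (Fin 2) (Fin 2) 𝕜, (∀ i, E i i = 0) ∧ ∀ i j,
        HasDerivAt (fun w => elementaryUnipotent (lower 0) (g 0 w) i j) (E i j) x := by
      have h := (hg 0).hasDerivAt
      cases lower 0
      · refine ⟨!![0, deriv (g 0) x; 0, 0], fun i => by fin_cases i <;> rfl, fun i j => ?_⟩
        fin_cases i <;> fin_cases j <;> simp [elementaryUnipotent, h, hasDerivAt_const]
      · refine ⟨!![0, 0; deriv (g 0) x, 0], fun i => by fin_cases i <;> rfl, fun i j => ?_⟩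
        fin_cases i <;> fin_cases j <;> simp [elementaryUnipotent, h, hasDerivAt_const]
    refine ⟨E + D, fun i => by simp [hE, hD], fun i j => ?_⟩
    simp only [List.ofFn_succ, List.prod_cons, Matrix.mul_apply]
    refine (HasDerivAt.fun_sum (u := Finset.univ) fun k _ =>
      (hF i k).fun_mul (hP k j)).congr_deriv ?_
    simp [hx, elementaryUnipotent_zero, Finset.sum_add_distrib, Matrix.one_apply]

/-- the counterexample from Section 1 of the paper. On the disc
`W = {|w - 1| < 1}` the map `G(w) = diag(1/w, w)` (which equals the identity at `w = 1`)
admits NO factorization into unipotent triangular matrix functions all of which equal the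
identity at `w = 1`. Here `lower i = true` means the `i`-th factor is unipotent lower
triangular, otherwise it is unipotent upper triangular. -/
theorem no_factorization_vanishing_at_base :
    ¬ ∃ (M : ℕ) (_ : 1 ≤ M) (g : Fin M → ℂ → ℂ) (lower : Fin M → Bool),
      (∀ i, DifferentiableOn ℂ (g i) (Metric.ball (1 : ℂ) 1)) ∧
      (∀ i, g i 1 = 0) ∧
      (∀ w ∈ Metric.ball (1 : ℂ) 1,
        (List.ofFn fun i : Fin M =>
            if lower i then !![(1 : ℂ), 0; g i w, 1] else !![(1 : ℂ), g i w; 0, 1]).prod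
          = !![w⁻¹, 0; 0, w]) := by
  rintro ⟨M, -, g, lower, hg, hg1, hprod⟩
  have hball : Metric.ball (1 : ℂ) 1 ∈ nhds 1 := Metric.ball_mem_nhds 1 one_pos
  obtain ⟨D, hD, hP⟩ := prod_elementaryUnipotent_hasDerivAt g lower
    (fun i => (hg i).differentiableAt hball) hg1
  have hid : HasDerivAt (fun w : ℂ => w) (D 1 1) 1 := by
    refine (hP 1 1).congr_of_eventuallyEq ?_
    filter_upwards [hball] with w hw
    simpa [elementaryUnipotent] using (congrFun₂ (hprod w hw) 1 1).symm
  exact one_ne_zero (((hasDerivAt_id' (1 : ℂ)).unique hid).trans (hD 1))
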